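/- Let L > 0, λ > 0, and 0 < ε ≤ L. Let h : [0,L] → ℝ be continuous with h(0) > 0 and (L−t)/2 ≤ h(t) ≤ 2(L−t) for all t ∈ [L−ε, L]. Then σ_rev(λ,h,L) ≤ (λ(L−ε) + (4+λ)ε/3)/h(0)². (This is the test-function estimate in the proof of the paper's Theorem on metrics of revolution, obtained from the function a equal to 1 on [0,L−ε] and equal to (L−t)/ε on [L−ε,L].) -/

import Mathlib

open Set intervalIntegral

/-- The revolution Steklov–Rayleigh infimum `σ_rev(λ, h, L)`: the infimum, over
continuously differentiable `a : ℝ → ℝ` with `a 0 = 1` and `a L = 0`, of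
`(1 / h(0)²) ∫₀ᴸ (a'(t)² h(t)² + λ a(t)²) dt`. -/
noncomputable def steklovRayleighRev (lam L : ℝ) (h : ℝ → ℝ) : ℝ :=
  sInf { x : ℝ | ∃ a : ℝ → ℝ, ContDiff ℝ 1 a ∧ a 0 = 1 ∧ a L = 0 ∧
    x = (1 / (h 0) ^ 2) *
      ∫ t in (0:ℝ)..L, ((deriv a t) ^ 2 * (h t) ^ 2 + lam * (a t) ^ 2) }

/-- A `C¹` function that vanishes at `0`, equals `1` on `[1, ∞)`, and approximates `s ↦ min s 1`
as `n → ∞`. -/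
noncomputable def smoothedMin (n : ℕ) (s : ℝ) : ℝ :=
  min s 1 * (1 + 1 / (n + 1)) - min s 1 ^ (n + 2) / (n + 1)

theorem hasDerivAt_smoothedMin (n : ℕ) (s : ℝ) :
    HasDerivAt (smoothedMin n) ((1 + 1 / (n + 1)) * (1 - min s 1 ^ (n + 1))) s := by
  have hpoly : ∀ x : ℝ, HasDerivAt
      (fun y : ℝ => y * (1 + 1 / ((n : ℝ) + 1)) - y ^ (n + 2) / (n + 1))
      ((1 + 1 / (n + 1)) * (1 - x ^ (n + 1))) x := by
    intro x
    refine (((hasDerivAt_id x).mul_const (1 + 1 / ((n : ℝ) + 1))).sub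
      ((hasDerivAt_pow (n + 2) x).div_const ((n : ℝ) + 1))).congr_deriv ?_
    rw [show n + 2 - 1 = n + 1 from rfl]
    push_cast
    field_simp
    ring
  have hleft : ∀ x ≤ (1 : ℝ), smoothedMin n x =
      x * (1 + 1 / ((n : ℝ) + 1)) - x ^ (n + 2) / (n + 1) := by
    intro x hx
    simp [smoothedMin, min_eq_left hx]
  have hright : ∀ x ≥ (1 : ℝ), smoothedMin n x = 1 := by
    intro x hx
    simp [smoothedMin, min_eq_right hx]
  rcases lt_trichotomy s 1 with hs | rfl | hs
  · rw [min_eq_left hs.le]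
    refine (hpoly s).congr_of_eventuallyEq ?_
    filter_upwards [Iio_mem_nhds hs] with x hx using hleft x (le_of_lt hx)
  · rw [← hasDerivWithinAt_univ, ← Iic_union_Ici (a := (1 : ℝ))]
    refine HasDerivWithinAt.union ?_ ?_
    · rw [min_self]
      exact (hpoly 1).hasDerivWithinAt.congr (fun x hx => hleft x hx) (hleft 1 le_rfl)
    · simpa using (hasDerivWithinAt_const (1 : ℝ) (Ici 1) (1 : ℝ)).congr
        (fun x hx => hright x hx) (hright 1 le_rfl)
  · rw [min_eq_right hs.le]
    simp only [one_pow, sub_self, mul_zero]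
    refine (hasDerivAt_const s (1 : ℝ)).congr_of_eventuallyEq ?_
    filter_upwards [Ioi_mem_nhds hs] with x hx using hright x (le_of_lt hx)

theorem smoothedMin_zero (n : ℕ) : smoothedMin n 0 = 0 := by
  simp [smoothedMin]

theorem smoothedMin_of_one_le (n : ℕ) {s : ℝ} (hs : 1 ≤ s) : smoothedMin n s = 1 := by
  simp [smoothedMin, min_eq_right hs]

theorem smoothedMin_nonneg (n : ℕ) {s : ℝ} (hs : s ∈ Icc (0 : ℝ) 1) : 0 ≤ smoothedMin n s := by
  have hpow : s ^ (n + 1) ≤ 1 := pow_le_one₀ hs.1 hs.2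
  have heq : smoothedMin n s = s + s * (1 - s ^ (n + 1)) / (n + 1) := by
    rw [smoothedMin, min_eq_left hs.2]
    field_simp
    ring
  rw [heq]
  have := mul_nonneg hs.1 (sub_nonneg.2 hpow)
  have := hs.1
  positivity

theorem smoothedMin_le (n : ℕ) {s : ℝ} (hs : s ∈ Icc (0 : ℝ) 1) :
    smoothedMin n s ≤ (1 + 1 / (n + 1)) * s := by
  rw [smoothedMin, min_eq_left hs.2]
  have := hs.1
  have : 0 ≤ s ^ (n + 2) / ((n : ℝ) + 1) := by positivity
  linarith

theorem steklovRayleighRev_le {lam L : ℝ} (hlam : 0 ≤ lam) (hL : 0 ≤ L) (h : ℝ → ℝ) {a : ℝ → ℝ}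
    (ha : ContDiff ℝ 1 a) (ha0 : a 0 = 1) (haL : a L = 0) :
    steklovRayleighRev lam L h ≤ (1 / (h 0) ^ 2) *
      ∫ t in (0:ℝ)..L, ((deriv a t) ^ 2 * (h t) ^ 2 + lam * (a t) ^ 2) := by
  refine csInf_le ⟨0, ?_⟩ ⟨a, ha, ha0, haL, rfl⟩
  rintro x ⟨b, -, -, -, rfl⟩
  have : 0 ≤ ∫ t in (0:ℝ)..L, ((deriv b t) ^ 2 * (h t) ^ 2 + lam * (b t) ^ 2) :=
    integral_nonneg hL fun t _ => by positivity
  positivity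

theorem steklovRayleighRev_le_smoothedMin (n : ℕ) {L lam ε : ℝ} (hL : 0 < L)
    (hlam : 0 < lam) (hε : 0 < ε) (hεL : ε ≤ L)
    {h : ℝ → ℝ} (hcont : Continuous h)
    (hcomp : ∀ t ∈ Icc (L - ε) L, 0 ≤ h t ∧ h t ≤ 2 * (L - t)) :
    steklovRayleighRev lam L h ≤
      (lam * (L - ε) + (1 + 1 / ((n : ℝ) + 1)) ^ 2 * ((4 + lam) * ε / 3)) / (h 0) ^ 2 := by
  set c : ℝ := 1 + 1 / ((n : ℝ) + 1)
  have hc0 : 0 < c := by positivity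
  set a : ℝ → ℝ := fun t => smoothedMin n ((L - t) / ε) with ha_def
  have hderiv : ∀ t, HasDerivAt a (c * (1 - min ((L - t) / ε) 1 ^ (n + 1)) * (-1 / ε)) t :=
    fun t => (hasDerivAt_smoothedMin n _).comp t (((hasDerivAt_id t).const_sub L).div_const ε)
  have hderiv_eq : deriv a = fun t => c * (1 - min ((L - t) / ε) 1 ^ (n + 1)) * (-1 / ε) :=
    funext fun t => (hderiv t).deriv
  have hderiv_cont : Continuous (deriv a) := by
    rw [hderiv_eq]
    fun_prop
  have ha : ContDiff ℝ 1 a :=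
    contDiff_one_iff_deriv.2 ⟨fun t => (hderiv t).differentiableAt, hderiv_cont⟩
  have ha_cont : Continuous a := ha.continuous
  have ha0 : a 0 = 1 := smoothedMin_of_one_le n (by rw [sub_zero, le_div_iff₀ hε]; linarith)
  have haL : a L = 0 := by simp [ha_def, smoothedMin_zero]
  refine (steklovRayleighRev_le hlam.le hL.le h ha ha0 haL).trans ?_
  rw [one_div_mul_eq_div]
  refine div_le_div_of_nonneg_right ?_ (sq_nonneg _)
  have hint : Continuous fun t => (deriv a t) ^ 2 * (h t) ^ 2 + lam * (a t) ^ 2 := by fun_prop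
  rw [← integral_add_adjacent_intervals (hint.intervalIntegrable 0 (L - ε))
    (hint.intervalIntegrable (L - ε) L)]
  refine add_le_add ?_ ?_
  · refine (integral_mono_on (by linarith) (hint.intervalIntegrable _ _)
      (continuous_const (y := lam) |>.intervalIntegrable _ _) ?_).trans ?_
    · intro t ht
      have hs : 1 ≤ (L - t) / ε := by
        rw [le_div_iff₀ hε]
        linarith [ht.2]
      have hat : a t = 1 := smoothedMin_of_one_le n hs
      simp [hderiv_eq, hat, min_eq_right hs]
    · simp [mul_comm]
  · refine (integral_mono_on (g := fun t => c ^ 2 * (4 + lam) / ε ^ 2 * (L - t) ^ 2)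
      (by linarith) (hint.intervalIntegrable _ _)
      (Continuous.intervalIntegrable (by fun_prop) _ _) ?_).trans ?_
    · intro t ht
      have hs : (L - t) / ε ∈ Icc (0 : ℝ) 1 :=
        ⟨div_nonneg (by linarith [ht.2]) hε.le, by rw [div_le_one hε]; linarith [ht.1]⟩
      have hat : a t ^ 2 ≤ (c * ((L - t) / ε)) ^ 2 :=
        pow_le_pow_left₀ (smoothedMin_nonneg n hs) (smoothedMin_le n hs) 2
      have hht : h t ^ 2 ≤ (2 * (L - t)) ^ 2 :=
        pow_le_pow_left₀ (hcomp t ht).1 (hcomp t ht).2 2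
      have hdt : deriv a t ^ 2 ≤ (c / ε) ^ 2 := by
        have hp0 : 0 ≤ ((L - t) / ε) ^ (n + 1) := pow_nonneg hs.1 _
        have hp1 : ((L - t) / ε) ^ (n + 1) ≤ 1 := pow_le_one₀ hs.1 hs.2
        have heq : deriv a t ^ 2 = (c / ε * (1 - ((L - t) / ε) ^ (n + 1))) ^ 2 := by
          simp only [hderiv_eq, min_eq_left hs.2]
          ring
        rw [heq]
        refine pow_le_pow_left₀ (mul_nonneg (by positivity) (by linarith)) ?_ 2
        exact mul_le_of_le_one_right (by positivity) (by linarith)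
      calc deriv a t ^ 2 * h t ^ 2 + lam * a t ^ 2
          ≤ (c / ε) ^ 2 * (2 * (L - t)) ^ 2 + lam * (c * ((L - t) / ε)) ^ 2 := by gcongr
        _ = c ^ 2 * (4 + lam) / ε ^ 2 * (L - t) ^ 2 := by ring
    · rw [integral_const_mul, integral_comp_sub_left (fun x => x ^ 2) L, integral_pow]
      refine le_of_eq ?_
      norm_num
      field_simp

theorem steklovRev_test_function_estimate (L lam ε : ℝ) (hL : 0 < L)
    (hlam : 0 < lam) (hε : 0 < ε) (hεL : ε ≤ L)
    (h : ℝ → ℝ) (hcont : Continuous h) (hh0 : 0 < h 0)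
    (hcomp : ∀ t ∈ Icc (L - ε) L, (L - t) / 2 ≤ h t ∧ h t ≤ 2 * (L - t)) :
    steklovRayleighRev lam L h ≤
      (lam * (L - ε) + (4 + lam) * ε / 3) / (h 0) ^ 2 := by
  have hbound := fun n : ℕ => steklovRayleighRev_le_smoothedMin n hL hlam hε hεL hcont
    fun t ht => ⟨(div_nonneg (sub_nonneg.2 ht.2) zero_le_two).trans (hcomp t ht).1,
      (hcomp t ht).2⟩
  refine ge_of_tendsto' (x := Filter.atTop) ?_ hbound
  have hlim := tendsto_one_div_add_atTop_nhds_zero_nat (𝕜 := ℝ)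
  simpa using (((((hlim.const_add 1).pow 2).mul_const
    ((4 + lam) * ε / 3)).const_add (lam * (L - ε))).div_const ((h 0) ^ 2))
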